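/- Let T1 : H1 → H1 and T2 : H2 → H2 be (possibly unbounded) self-adjoint operators on Hilbert spaces, and suppose there exist linear isometries U1 : H1 → H2 and U2 : H2 → H1 such that U1 ∘ T1 ⊆ T2 ∘ U1 and U2 ∘ T2 ⊆ T1 ∘ U2 (inclusion of graphs). Then there is a unitary U : H1 → H2 with U ∘ T1 ∘ U⁻¹ = T2. -/

import Mathlib

open Filter Topology ContinuousLinearMap
open scoped InnerProduct

namespace LinearPMap

variable {E F G : Type*}
  [NormedAddCommGroup E] [InnerProductSpace ℂ E]
  [NormedAddCommGroup F] [InnerProductSpace ℂ F]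
  [NormedAddCommGroup G] [InnerProductSpace ℂ G]

/-- A bounded operator `B` intertwines `T` and `S` if `B ∘ T ⊆ S ∘ B`. -/
def Intertwines (T : E →ₗ.[ℂ] E) (S : F →ₗ.[ℂ] F) (B : E →L[ℂ] F) : Prop :=
  ∀ x x', (x, x') ∈ T.graph → (B x, B x') ∈ S.graph

namespace Intertwines

variable {T : E →ₗ.[ℂ] E} {S : F →ₗ.[ℂ] F} {R : G →ₗ.[ℂ] G}

theorem of_domain {B : E →L[ℂ] F} (hdom : ∀ x : T.domain, B x ∈ S.domain)
    (h : ∀ (x : T.domain) (y : S.domain), (y : F) = B x → S y = B (T x)) :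
    Intertwines T S B := by
  intro x x' hx
  obtain ⟨z, rfl, rfl⟩ := T.mem_graph_iff.1 hx
  exact S.mem_graph_iff.2 ⟨⟨B z, hdom z⟩, rfl, h z ⟨B z, hdom z⟩ rfl⟩

theorem mem_domain {B : E →L[ℂ] F} (h : Intertwines T S B) {x : E} (hx : x ∈ T.domain) :
    B x ∈ S.domain := by
  obtain ⟨z, hz, -⟩ := S.mem_graph_iff.1 (h _ _ (T.mem_graph ⟨x, hx⟩))
  have hz' : B x = z := hz.symm
  exact hz' ▸ z.2

theorem map_apply {B : E →L[ℂ] F} (h : Intertwines T S B) (x : T.domain) (y : S.domain)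
    (hy : (y : F) = B x) : S y = B (T x) :=
  S.mem_graph_snd_inj (S.mem_graph y) (h _ _ (T.mem_graph x)) hy

theorem zero : Intertwines T S 0 := fun _ _ _ => S.graph.zero_mem

theorem id : Intertwines T T (ContinuousLinearMap.id ℂ E) := fun _ _ h => h

theorem add {B C : E →L[ℂ] F} (hB : Intertwines T S B) (hC : Intertwines T S C) :
    Intertwines T S (B + C) :=
  fun _ _ h => S.graph.add_mem (hB _ _ h) (hC _ _ h)

theorem sub {B C : E →L[ℂ] F} (hB : Intertwines T S B) (hC : Intertwines T S C) :
    Intertwines T S (B - C) :=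
  fun _ _ h => S.graph.sub_mem (hB _ _ h) (hC _ _ h)

theorem comp {C : F →L[ℂ] G} {B : E →L[ℂ] F} (hC : Intertwines S R C)
    (hB : Intertwines T S B) : Intertwines T R (C ∘L B) :=
  fun _ _ h => hC _ _ (hB _ _ h)

theorem adjoint [CompleteSpace E] [CompleteSpace F] {B : E →L[ℂ] F} (h : Intertwines T S B)
    (hT : IsSelfAdjoint T) (hS : IsSelfAdjoint S) : Intertwines S T (B†) := by
  intro y y' hy
  rw [← isSelfAdjoint_def.1 hS, adjoint_graph_eq_graph_adjoint hS.dense_domain,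
    Submodule.mem_adjoint_iff] at hy
  rw [← isSelfAdjoint_def.1 hT, adjoint_graph_eq_graph_adjoint hT.dense_domain,
    Submodule.mem_adjoint_iff]
  intro x x' hx
  simpa [adjoint_inner_right] using hy _ _ (h _ _ hx)

/-- Intertwining operators are stable under pointwise limits when the target operator is
closed. -/
theorem of_tendsto {B : ℕ → E →L[ℂ] F} {C : E →L[ℂ] F} (hS : S.IsClosed)
    (hB : ∀ n, Intertwines T S (B n)) (h : ∀ x, Tendsto (fun n => B n x) atTop (𝓝 (C x))) :
    Intertwines T S C := fun x x' hx =>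
  hS.mem_of_tendsto ((h x).prodMk_nhds (h x')) (.of_forall fun n => hB n x x' hx)

end Intertwines

end LinearPMap

section WanderingProjection

variable {E : Type*} [NormedAddCommGroup E] [InnerProductSpace ℂ E]

/-- A monotone sequence of star projections converges pointwise to a star projection. -/
theorem exists_tendsto_of_isStarProjection [CompleteSpace E] {p : ℕ → E →L[ℂ] E}
    (hp : ∀ n, IsStarProjection (p n)) (hmono : ∀ n, p (n + 1) * p n = p n) :
    ∃ P : E →L[ℂ] E, IsStarProjection P ∧ ∀ x, Tendsto (fun n => p n x) atTop (𝓝 (P x)) := by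
  choose inst hEq using fun n => isStarProjection_iff_eq_starProjection_range.1 (hp n)
  have hM : Monotone fun n => (p n).range := by
    refine monotone_nat_of_le_succ fun n => ?_
    rintro _ ⟨x, rfl⟩
    exact ⟨p n x, congr($(hmono n) x)⟩
  refine ⟨(⨆ n, (p n).range).topologicalClosure.starProjection,
    isStarProjection_starProjection, fun x => ?_⟩
  have := Submodule.starProjection_tendsto_closure_iSup (fun n => (p n).range) hM x
  exact this.congr fun n => congr($(hEq n) x).symm

/-- The partial sums `∑ k < n, V ^ k Q V* ^ k`. -/
noncomputable def wanderingSum [CompleteSpace E] (V Q : E →L[ℂ] E) : ℕ → E →L[ℂ] E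
  | 0 => 0
  | n + 1 => Q + V * wanderingSum V Q n * star V

variable [CompleteSpace E] {V Q : E →L[ℂ] E}

theorem isStarProjection_wanderingSum (hV : star V * V = 1) (hQ : IsStarProjection Q)
    (hQV : Q * V = 0) (n : ℕ) : IsStarProjection (wanderingSum V Q n) := by
  have hVQ : star V * Q = 0 := by
    simpa [hQ.isSelfAdjoint.star_eq] using congr(star $hQV)
  have hV' (X : E →L[ℂ] E) : star V * (V * X) = X := by rw [← mul_assoc, hV, one_mul]
  have hQV' (X : E →L[ℂ] E) : Q * (V * X) = 0 := by rw [← mul_assoc, hQV, zero_mul]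
  induction n with
  | zero => exact .zero _
  | succ n ih =>
    refine ⟨?_, ?_⟩
    · have hi (X : E →L[ℂ] E) :
          wanderingSum V Q n * (wanderingSum V Q n * X) = wanderingSum V Q n * X := by
        rw [← mul_assoc, ih.isIdempotentElem.eq]
      simp [IsIdempotentElem, wanderingSum, mul_add, add_mul, mul_assoc, hV', hQV', hVQ, hi,
        hQ.isIdempotentElem.eq]
    · simp [isSelfAdjoint_iff, wanderingSum, mul_assoc, hQ.isSelfAdjoint.star_eq,
        ih.isSelfAdjoint.star_eq]

theorem wanderingSum_succ_mul_self (hV : star V * V = 1) (hQ : IsStarProjection Q)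
    (hQV : Q * V = 0) (n : ℕ) :
    wanderingSum V Q (n + 1) * wanderingSum V Q n = wanderingSum V Q n := by
  have hVQ : star V * Q = 0 := by
    simpa [hQ.isSelfAdjoint.star_eq] using congr(star $hQV)
  have hV' (X : E →L[ℂ] E) : star V * (V * X) = X := by rw [← mul_assoc, hV, one_mul]
  have hQV' (X : E →L[ℂ] E) : Q * (V * X) = 0 := by rw [← mul_assoc, hQV, zero_mul]
  induction n with
  | zero => simp [wanderingSum]
  | succ n ih =>
    have hi (X : E →L[ℂ] E) :
        wanderingSum V Q (n + 1) * (wanderingSum V Q n * X) = wanderingSum V Q n * X := by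
      rw [← mul_assoc, ih]
    rw [wanderingSum.eq_2 V Q (n + 1)]
    nth_rw 2 3 [wanderingSum.eq_2]
    simp [mul_add, add_mul, mul_assoc, hV', hQV', hVQ, hi, hQ.isIdempotentElem.eq]

/-- If `V` is an isometry commuting with the self-adjoint operator `T` and `Q` is a projection
commuting with `T` whose range is orthogonal to the range of `V`, then the projection `P` onto the
closed span of the subspaces `V ^ n (range Q)` commutes with `T` and satisfies `P = Q + V P V*`. -/
theorem exists_isStarProjection_eq_add {T : E →ₗ.[ℂ] E} (hT : IsSelfAdjoint T)
    (hV : star V * V = 1) (hQ : IsStarProjection Q) (hQV : Q * V = 0)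
    (hTV : T.Intertwines T V) (hTQ : T.Intertwines T Q) :
    ∃ P : E →L[ℂ] E, IsStarProjection P ∧ P = Q + V * P * star V ∧ T.Intertwines T P := by
  obtain ⟨P, hP, hlim⟩ := exists_tendsto_of_isStarProjection
    (isStarProjection_wanderingSum hV hQ hQV) (wanderingSum_succ_mul_self hV hQ hQV)
  refine ⟨P, hP, ?_, .of_tendsto hT.isClosed (fun n => ?_) hlim⟩
  · ext x
    refine tendsto_nhds_unique ((hlim x).comp (tendsto_add_atTop_nat 1)) ?_
    exact ((V.continuous.tendsto _).comp (hlim (star V x))).const_add (Q x)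
  · induction n with
    | zero => exact .zero
    | succ n ih => exact hTQ.add ((hTV.comp ih).comp (hTV.adjoint hT hT))

end WanderingProjection

/-- Schröder–Bernstein for isometries `A` and `B`: if the projection `P` satisfies
`P = (1 - B B*) + (B A) P (B A)*`, then `A P + B* (1 - P)` is unitary. -/
theorem exists_linearIsometryEquiv_of_eq_add {E F : Type*}
    [NormedAddCommGroup E] [InnerProductSpace ℂ E] [CompleteSpace E]
    [NormedAddCommGroup F] [InnerProductSpace ℂ F] [CompleteSpace F]
    {A : E →L[ℂ] F} {B : F →L[ℂ] E} {P : E →L[ℂ] E}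
    (hA : ∀ x, (A†) (A x) = x) (hB : ∀ y, (B†) (B y) = y) (hP : IsStarProjection P)
    (h : ∀ x, P x = x - B ((B†) x) + B (A (P ((A†) ((B†) x))))) :
    ∃ U : E ≃ₗᵢ[ℂ] F,
      (U : E →L[ℂ] F) = A ∘L P + (B†) ∘L (ContinuousLinearMap.id ℂ E - P) ∧
      (U.symm : F →L[ℂ] E) = P ∘L (A†) + (ContinuousLinearMap.id ℂ E - P) ∘L B := by
  have hPP (x : E) : P (P x) = P x := congr($(hP.isIdempotentElem.eq) x)
  have hbP (x : E) : (B†) (P x) = A (P ((A†) ((B†) x))) := by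
    rw [h x]; simp [hB]
  have haP (x : E) : (A†) ((B†) (P x)) = P ((A†) ((B†) x)) := by rw [hbP, hA]
  have hPV (x : E) : P (B (A x)) = B (A (P x)) := by
    rw [h]; simp [hA, hB]
  have hBbP (x : E) : B ((B†) (P x)) = P x - x + B ((B†) x) := by
    rw [hbP, h x]; abel
  have left (x : E) : (P ∘L (A†) + (ContinuousLinearMap.id ℂ E - P) ∘L B)
      ((A ∘L P + (B†) ∘L (ContinuousLinearMap.id ℂ E - P)) x) = x := by
    simp only [add_apply, sub_apply, comp_apply, id_apply, map_add, map_sub, hA, haP, hPP, hPV,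
      hBbP]
    abel
  have right (y : F) : (A ∘L P + (B†) ∘L (ContinuousLinearMap.id ℂ E - P))
      ((P ∘L (A†) + (ContinuousLinearMap.id ℂ E - P) ∘L B) y) = y := by
    simp [hPP, hbP, hB]
  have hadj : (A ∘L P + (B†) ∘L (ContinuousLinearMap.id ℂ E - P))† =
      P ∘L (A†) + (ContinuousLinearMap.id ℂ E - P) ∘L B := by
    have hP' : P† = P := hP.isSelfAdjoint
    simp [adjoint_comp, hP']
  let U : E ≃ₗᵢ[ℂ] F :=
    { (A ∘L P + (B†) ∘L (ContinuousLinearMap.id ℂ E - P) : E →L[ℂ] F).toLinearMap with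
      invFun := (P ∘L (A†) + (ContinuousLinearMap.id ℂ E - P) ∘L B : F →L[ℂ] E)
      left_inv := left
      right_inv := right
      norm_map' := (norm_map_iff_adjoint_comp_self _).2 (by
        rw [hadj]; ext x; exact left x) }
  exact ⟨U, rfl, rfl⟩

/-- Schröder–Bernstein for unbounded self-adjoint operators: if `T1`, `T2` are self-adjoint
operators and there are linear isometries `U1`, `U2` with `U1 ∘ T1 ⊆ T2 ∘ U1` and
`U2 ∘ T2 ⊆ T1 ∘ U2`, then `T1` and `T2` are unitarily equivalent. -/
theorem schroeder_bernstein_selfAdjoint_unbounded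
    {H1 H2 : Type*}
    [NormedAddCommGroup H1] [InnerProductSpace ℂ H1] [CompleteSpace H1]
    [NormedAddCommGroup H2] [InnerProductSpace ℂ H2] [CompleteSpace H2]
    (T1 : H1 →ₗ.[ℂ] H1) (T2 : H2 →ₗ.[ℂ] H2)
    (hT1 : IsSelfAdjoint T1) (hT2 : IsSelfAdjoint T2)
    (U1 : H1 →ₗᵢ[ℂ] H2) (U2 : H2 →ₗᵢ[ℂ] H1)
    (hU1dom : ∀ x : T1.domain, (U1 x : H2) ∈ T2.domain)
    (hU1 : ∀ (x : T1.domain) (y : T2.domain), (y : H2) = U1 x → T2 y = U1 (T1 x))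
    (hU2dom : ∀ y : T2.domain, (U2 y : H1) ∈ T1.domain)
    (hU2 : ∀ (y : T2.domain) (x : T1.domain), (x : H1) = U2 y → T1 x = U2 (T2 y)) :
    ∃ U : H1 ≃ₗᵢ[ℂ] H2,
      (∀ x : H1, x ∈ T1.domain ↔ U x ∈ T2.domain) ∧
      (∀ (x : T1.domain) (y : T2.domain), (y : H2) = U x → T2 y = U (T1 x)) := by
  let A : H1 →L[ℂ] H2 := U1.toContinuousLinearMap
  let B : H2 →L[ℂ] H1 := U2.toContinuousLinearMap
  have hA : T1.Intertwines T2 A := .of_domain hU1dom hU1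
  have hB : T2.Intertwines T1 B := .of_domain hU2dom hU2
  have hAA (x : H1) : (A†) (A x) = x :=
    congr($((norm_map_iff_adjoint_comp_self A).1 U1.norm_map) x)
  have hBB (y : H2) : (B†) (B y) = y :=
    congr($((norm_map_iff_adjoint_comp_self B).1 U2.norm_map) y)
  have hA' := hA.adjoint hT1 hT2
  have hB' := hB.adjoint hT2 hT1
  have hV : star (B ∘L A) = (A†) ∘L (B†) := adjoint_comp B A
  obtain ⟨P, hP, hPeq, hTP⟩ := exists_isStarProjection_eq_add (V := B ∘L A)
    (Q := ContinuousLinearMap.id ℂ H1 - B ∘L (B†)) hT1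
    (by rw [hV]; ext x; simp [hAA, hBB])
    ⟨by ext x; simp [hBB], by
      have h1 : (ContinuousLinearMap.id ℂ H1)† = ContinuousLinearMap.id ℂ H1 :=
        star_one (H1 →L[ℂ] H1)
      simp [isSelfAdjoint_iff, star_eq_adjoint, adjoint_comp, h1]⟩
    (by ext x; simp [hBB]) (hB.comp hA) (.sub .id (hB.comp hB'))
  rw [hV] at hPeq
  obtain ⟨U, hU, hUsymm⟩ := exists_linearIsometryEquiv_of_eq_add hAA hBB hP
    fun x => congr($hPeq x)
  have hTU : T1.Intertwines T2 (U : H1 →L[ℂ] H2) :=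
    hU ▸ (hA.comp hTP).add (hB'.comp (.sub .id hTP))
  have hTU' : T2.Intertwines T1 (U.symm : H2 →L[ℂ] H1) :=
    hUsymm ▸ (hTP.comp hA').add (.comp (.sub .id hTP) hB)
  refine ⟨U, fun x => ⟨fun hx => hTU.mem_domain hx, fun hx => ?_⟩, hTU.map_apply⟩
  simpa using hTU'.mem_domain hx
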